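/- Let d ≥ 2, let μ be the normalized Haar probability measure on the unitary group U(d), let S be the swap operator on ℂ^d⊗ℂ^d and I the d²×d² identity. Then for every d²×d² complex matrix σ, ∫_{U(d)} (U⊗U)·σ·(U⊗U)* dμ(U) = [(tr(σ) − tr(S·σ)/d)/(d²−1)]·I + [(tr(S·σ) − tr(σ)/d)/(d²−1)]·S. For d = 2 this gives the Haar-averaged single-qubit gate C̄(σ) = (tr((I−S/2)σ)/3)·I + (tr((S−I/2)σ)/3)·S, and for d = 4 the Haar-averaged two-qubit gate C̄(σ) = (tr((I−S/4)σ)/15)·I + (tr((S−I/4)σ)/15)·S used in the statistical mechanics mapping. -/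

import Mathlib

open Kronecker MeasureTheory
open scoped Matrix

/-- The swap operator on `ℂ^n ⊗ ℂ^n`: `S(u⊗v) = v⊗u`. -/
def swapOp (n : ℕ) : Matrix (Fin n × Fin n) (Fin n × Fin n) ℂ :=
  Matrix.of fun p q => if p.1 = q.2 ∧ p.2 = q.1 then (1 : ℂ) else 0

namespace HaarTwirl

variable {n : ℕ}

/-- infinitesimal two-copy action -/
def D (X : Matrix (Fin n) (Fin n) ℂ) : Matrix (Fin n × Fin n) (Fin n × Fin n) ℂ :=
  X ⊗ₖ (1 : Matrix (Fin n) (Fin n) ℂ) + (1 : Matrix (Fin n) (Fin n) ℂ) ⊗ₖ X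

lemma D_add (X Y : Matrix (Fin n) (Fin n) ℂ) : D (X + Y) = D X + D Y := by
  simp only [D, Matrix.add_kronecker, Matrix.kronecker_add]; abel

lemma D_smul (c : ℂ) (X : Matrix (Fin n) (Fin n) ℂ) : D (c • X) = c • D X := by
  simp only [D, Matrix.smul_kronecker, Matrix.kronecker_smul, smul_add]

lemma kron_phase (z : ℂ) (P : Matrix (Fin n) (Fin n) ℂ) :
    (1 + z • P) ⊗ₖ (1 + z • P) = 1 + z • D P + z ^ 2 • (P ⊗ₖ P) := by
  simp only [D, Matrix.smul_kronecker, Matrix.kronecker_smul, smul_add, Matrix.add_kronecker,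
    Matrix.kronecker_add, Matrix.one_kronecker_one, smul_smul]
  rw [pow_two]; abel

lemma phase_unitary (z : ℂ) (hz : z + star z + z * star z = 0) (P : Matrix (Fin n) (Fin n) ℂ)
    (hP : Pᴴ = P) (hPP : P * P = P) : (1 + z • P) ∈ Matrix.unitaryGroup (Fin n) ℂ := by
  rw [Matrix.mem_unitaryGroup_iff]
  rw [Matrix.star_eq_conjTranspose]
  simp only [Matrix.conjTranspose_add, Matrix.conjTranspose_smul, hP, Matrix.conjTranspose_one,
    mul_add, add_mul, one_mul, mul_one, Matrix.smul_mul, Matrix.mul_smul, hPP, smul_smul]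
  have : (1 : Matrix (Fin n) (Fin n) ℂ) + z • P + (star z • P + (star z * z) • P)
      = 1 + (z + star z + z * star z) • P := by
    rw [add_smul, add_smul, mul_comm]; abel
  rw [this, hz, zero_smul, add_zero]

variable (M : Matrix (Fin n × Fin n) (Fin n × Fin n) ℂ)

lemma comm_proj (hM : ∀ V ∈ Matrix.unitaryGroup (Fin n) ℂ, Commute M (V ⊗ₖ V))
    (P : Matrix (Fin n) (Fin n) ℂ) (hP : Pᴴ = P) (hPP : P * P = P) : Commute M (D P) := by
  have h1 := hM _ (phase_unitary (-2) (by norm_num) P hP hPP)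
  have h2 := hM _ (phase_unitary (Complex.I - 1) (by
    simp only [star_sub, Complex.star_def, Complex.conj_I, star_one, map_sub, map_one]
    linear_combination (-1 : ℂ) * Complex.I_sq) P hP hPP)
  rw [kron_phase] at h1 h2
  have h3 := (h1.sub_right (Commute.one_right M))
  have h4 := (h2.sub_right (Commute.one_right M))
  -- eliminate the quadratic term
  have h5 := (h3.smul_right ((Complex.I - 1) ^ 2)).sub_right (h4.smul_right (4 : ℂ))
  have h6 : (Complex.I - 1) ^ 2 • (1 + (-2 : ℂ) • D P + (-2 : ℂ) ^ 2 • (P ⊗ₖ P) - 1)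
      - (4 : ℂ) • (1 + (Complex.I - 1) • D P + (Complex.I - 1) ^ 2 • (P ⊗ₖ P) - 1)
      = (4 : ℂ) • D P := by
    have : (4 : ℂ) = (Complex.I - 1) ^ 2 * (-2) - 4 * (Complex.I - 1) := by
      linear_combination 2 * Complex.I_sq
    conv_rhs => rw [this]
    module
  rw [h6] at h5
  have := h5.smul_right ((4 : ℂ)⁻¹)
  rwa [smul_smul, inv_mul_cancel₀ (by norm_num), one_smul] at this

open scoped ComplexOrder in
lemma comm_rankone (hM : ∀ V ∈ Matrix.unitaryGroup (Fin n) ℂ, Commute M (V ⊗ₖ V))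
    (v : Fin n → ℂ) : Commute M (D (Matrix.vecMulVec v (star v))) := by
  by_cases hv : v = 0
  · subst hv
    simp [D]
  have hc : star v ⬝ᵥ v ≠ 0 := by
    rwa [Ne, dotProduct_star_self_eq_zero]
  set c := star v ⬝ᵥ v with hcdef
  have hcs : star c = c := by
    simp [hcdef, dotProduct, mul_comm]
  have h := comm_proj M hM (c⁻¹ • Matrix.vecMulVec v (star v))
    (by
      rw [Matrix.conjTranspose_smul, Matrix.conjTranspose_vecMulVec, star_inv₀, hcs, star_star])
    (by
      rw [Matrix.smul_mul, Matrix.mul_smul, Matrix.vecMulVec_mul_vecMulVec, ← hcdef]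
      rw [Matrix.vecMulVec_smul, smul_smul, smul_smul]
      congr 1
      field_simp)
  rw [D_smul] at h
  have := h.smul_right c
  rwa [smul_smul, mul_inv_cancel₀ hc, one_smul] at this

lemma comm_single (hM : ∀ V ∈ Matrix.unitaryGroup (Fin n) ℂ, Commute M (V ⊗ₖ V))
    (v w : Fin n → ℂ) : Commute M (D (Matrix.vecMulVec v (star w))) := by
  have h : ∀ z : ℂ, Commute M (z • D (Matrix.vecMulVec (v + z • w) (star (v + z • w)))) :=
    fun z => (comm_rankone M hM _).smul_right z
  have h1 := ((h 1).add_right (h (-1))).add_right ((h Complex.I).add_right (h (-Complex.I)))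
  have h2 := h1.smul_right ((4 : ℂ)⁻¹)
  simp only [← D_smul, ← D_add] at h2
  refine (congrArg (fun X => Commute M (D X)) ?_).mp h2
  ext i j
  simp [Matrix.vecMulVec_apply]
  ring_nf
  simp [Complex.I_sq, pow_succ]
  try ring

lemma comm_entry (hM : ∀ V ∈ Matrix.unitaryGroup (Fin n) ℂ, Commute M (V ⊗ₖ V))
    (a b i j k l : Fin n) :
    (if b = k then M (i, j) (a, l) else 0) + (if b = l then M (i, j) (k, a) else 0)
      = (if i = a then M (b, j) (k, l) else 0) + (if j = a then M (i, b) (k, l) else 0) := by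
  have h := comm_single M hM (Pi.single a 1) (Pi.single b 1)
  have h' := congrFun (congrFun h.eq (i, j)) (k, l)
  simp only [D, mul_add, add_mul, Matrix.add_apply, Matrix.mul_apply, Fintype.sum_prod_type,
    Matrix.kroneckerMap_apply, Matrix.vecMulVec_apply, Matrix.one_apply, Pi.star_apply,
    Pi.single_apply] at h'
  simpa [apply_ite star, Finset.sum_add_distrib, Finset.sum_ite_eq, ite_and, eq_comm, Finset.sum_ite_irrel] using h'

lemma commutant (hn : 2 ≤ n)
    (hM : ∀ V ∈ Matrix.unitaryGroup (Fin n) ℂ, Commute M (V ⊗ₖ V)) :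
    M = ((M.trace - (swapOp n * M).trace / (n : ℂ)) / ((n : ℂ) ^ 2 - 1)) •
            (1 : Matrix (Fin n × Fin n) (Fin n × Fin n) ℂ) +
          (((swapOp n * M).trace - M.trace / (n : ℂ)) / ((n : ℂ) ^ 2 - 1)) • swapOp n := by
  have E := comm_entry M hM
  set T : Fin n → Fin n → ℂ := fun j l => ∑ b, M (b, j) (b, l) with hT
  set R : Fin n → Fin n → ℂ := fun i l => ∑ b, M (i, b) (b, l) with hR
  have hTs : ∀ a b j l, (if b = l then T j a else 0) = (if j = a then T b l else 0) := by
    intro a b j l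
    have := Finset.sum_congr (rfl : (Finset.univ : Finset (Fin n)) = Finset.univ)
      (fun i _ => E a b i j i l)
    simpa [Finset.sum_add_distrib, Finset.sum_ite_irrel, hT] using this
  have hRs : ∀ a b i l, (if b = l then R i a else 0) = (if i = a then R b l else 0) := by
    intro a b i l
    have := Finset.sum_congr (rfl : (Finset.univ : Finset (Fin n)) = Finset.univ)
      (fun j _ => E a b i j j l)
    simp [Finset.sum_add_distrib, Finset.sum_ite_irrel] at this
    rw [add_comm] at this
    simpa [hR] using this
  have hS : ∀ i j a l, (n : ℂ) * M (i, j) (a, l) + M (i, j) (l, a)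
      = (if i = a then T j l else 0) + (if j = a then R i l else 0) := by
    intro i j a l
    have := Finset.sum_congr (rfl : (Finset.univ : Finset (Fin n)) = Finset.univ)
      (fun b _ => E a b i j b l)
    simpa [Finset.sum_add_distrib, Finset.sum_ite_irrel, hT, hR] using this
  have hn0 : (n : ℂ) ≠ 0 := by
    have : n ≠ 0 := by omega
    exact_mod_cast this
  have hn1 : (n : ℂ) ^ 2 - 1 ≠ 0 := by
    intro h
    have h' : (n : ℂ) ^ 2 = 1 := by linear_combination h
    have h'' : n ^ 2 = 1 := by exact_mod_cast h'
    nlinarith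
  have hTt : M.trace = ∑ j, T j j := by
    simp only [Matrix.trace, Matrix.diag_apply, Fintype.sum_prod_type, hT]
    rw [Finset.sum_comm]
  have hRt : (swapOp n * M).trace = ∑ j, R j j := by
    simp only [Matrix.trace, Matrix.diag_apply, Fintype.sum_prod_type, hR, Matrix.mul_apply,
      swapOp, Matrix.of_apply, ite_and]
    simp [Finset.sum_ite_irrel]
    rw [Finset.sum_comm]
  have hTv : ∀ j a, T j a = if j = a then M.trace / n else 0 := by
    intro j a
    have := Finset.sum_congr (rfl : (Finset.univ : Finset (Fin n)) = Finset.univ)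
      (fun b _ => hTs a b j b)
    simp [Finset.sum_ite_irrel, ← hTt] at this
    split_ifs at this ⊢ with h
    · rw [← this]; field_simp
    · simpa [hn0] using this
  have hRv : ∀ j a, R j a = if j = a then (swapOp n * M).trace / n else 0 := by
    intro j a
    have := Finset.sum_congr (rfl : (Finset.univ : Finset (Fin n)) = Finset.univ)
      (fun b _ => hRs a b j b)
    simp [Finset.sum_ite_irrel, ← hRt] at this
    split_ifs at this ⊢ with h
    · rw [← this]; field_simp
    · simpa [hn0] using this
  ext ⟨i, j⟩ ⟨a, l⟩
  have e1 := hS i j a l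
  have e2 := hS i j l a
  simp only [hTv, hRv] at e1 e2
  generalize M.trace = t at *
  generalize (swapOp n * M).trace = r at *
  have key : ((n : ℂ) ^ 2 - 1) * M (i, j) (a, l)
      = (t - r / n) * (if i = a ∧ j = l then 1 else 0)
        + (r - t / n) * (if i = l ∧ j = a then 1 else 0) := by
    have e3 : ((n : ℂ) ^ 2 - 1) * M (i, j) (a, l) = n * (n * M (i, j) (a, l) + M (i, j) (l, a))
      - (n * M (i, j) (l, a) + M (i, j) (a, l)) := by ring
    rw [e3, e1, e2]
    simp only [ite_and]
    split_ifs <;> field_simp <;> ring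
  simp only [Matrix.add_apply, Matrix.smul_apply, smul_eq_mul, Matrix.one_apply, swapOp,
    Matrix.of_apply, Prod.mk.injEq]
  rw [div_mul_eq_mul_div, div_mul_eq_mul_div, ← add_div, ← key]
  field_simp

lemma swap_comm (V : Matrix (Fin n) (Fin n) ℂ) :
    swapOp n * (V ⊗ₖ V) = (V ⊗ₖ V) * swapOp n := by
  ext ⟨i, j⟩ ⟨k, l⟩
  simp [Matrix.mul_apply, swapOp, Fintype.sum_prod_type, ite_and, Finset.sum_ite_irrel, mul_comm]

lemma kron_unitary (V : Matrix.unitaryGroup (Fin n) ℂ) :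
    ((V : Matrix (Fin n) (Fin n) ℂ) ⊗ₖ (V : Matrix (Fin n) (Fin n) ℂ))ᴴ *
      ((V : Matrix (Fin n) (Fin n) ℂ) ⊗ₖ (V : Matrix (Fin n) (Fin n) ℂ)) = 1 := by
  rw [Matrix.conjTranspose_kronecker, ← Matrix.mul_kronecker_mul, ← Matrix.star_eq_conjTranspose,
    Matrix.mem_unitaryGroup_iff'.1 V.2, Matrix.one_kronecker_one]

/-- integrand -/
def F (σ : Matrix (Fin n × Fin n) (Fin n × Fin n) ℂ) (U : Matrix.unitaryGroup (Fin n) ℂ) :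
    Matrix (Fin n × Fin n) (Fin n × Fin n) ℂ :=
  ((U : Matrix (Fin n) (Fin n) ℂ) ⊗ₖ (U : Matrix (Fin n) (Fin n) ℂ)) * σ *
            (((U : Matrix (Fin n) (Fin n) ℂ) ⊗ₖ (U : Matrix (Fin n) (Fin n) ℂ))ᴴ)

variable (σ : Matrix (Fin n × Fin n) (Fin n × Fin n) ℂ)

lemma F_mul (V U : Matrix.unitaryGroup (Fin n) ℂ) :
    F σ (V * U) = ((V : Matrix (Fin n) (Fin n) ℂ) ⊗ₖ (V : Matrix (Fin n) (Fin n) ℂ)) * F σ U *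
            (((V : Matrix (Fin n) (Fin n) ℂ) ⊗ₖ (V : Matrix (Fin n) (Fin n) ℂ))ᴴ) := by
  simp only [F, Submonoid.coe_mul, Matrix.mul_kronecker_mul, Matrix.conjTranspose_mul, mul_assoc]

lemma F_trace (U : Matrix.unitaryGroup (Fin n) ℂ) : (F σ U).trace = σ.trace := by
  rw [F, Matrix.trace_mul_comm, ← mul_assoc, kron_unitary, one_mul]

lemma F_swap_trace (U : Matrix.unitaryGroup (Fin n) ℂ) :
    (swapOp n * F σ U).trace = (swapOp n * σ).trace := by
  rw [F, ← mul_assoc, ← mul_assoc, swap_comm, Matrix.trace_mul_comm, ← mul_assoc, ← mul_assoc,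
    kron_unitary, one_mul]

lemma F_cont (p q : Fin n × Fin n) : Continuous (fun U => F σ U p q) := by
  have h : ∀ i j, Continuous (fun U : Matrix.unitaryGroup (Fin n) ℂ =>
      (U : Matrix (Fin n) (Fin n) ℂ) i j) := fun i j =>
    (continuous_subtype_val).matrix_elem i j
  simp only [F, Matrix.mul_apply, Matrix.kroneckerMap_apply, Matrix.conjTranspose_apply]
  exact continuous_finsetSum _ fun x _ => (continuous_finsetSum _ fun y _ =>
    ((h _ _).mul (h _ _)).mul continuous_const).mul ((h _ _).mul (h _ _)).star

lemma F_bound (p q : Fin n × Fin n) : ∃ C : ℝ, ∀ U, ‖F σ U p q‖ ≤ C := by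
  have h : ∀ (U : Matrix.unitaryGroup (Fin n) ℂ) i j, ‖(U : Matrix (Fin n) (Fin n) ℂ) i j‖ ≤ 1 :=
    fun U i j => entry_norm_bound_of_unitary U.2 i j
  refine ⟨∑ x, (∑ y, ‖σ y x‖), fun U => ?_⟩
  simp only [F, Matrix.mul_apply, Matrix.kroneckerMap_apply, Matrix.conjTranspose_apply]
  refine (norm_sum_le _ _).trans (Finset.sum_le_sum fun x _ => ?_)
  rw [norm_mul, norm_star, norm_mul]
  refine (mul_le_of_le_one_right (norm_nonneg _)
    (mul_le_one₀ (h U _ _) (norm_nonneg _) (h U _ _))).trans ?_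
  refine (norm_sum_le _ _).trans (Finset.sum_le_sum fun y _ => ?_)
  rw [norm_mul, norm_mul]
  exact mul_le_of_le_one_left (norm_nonneg _) (mul_le_one₀ (h U _ _) (norm_nonneg _) (h U _ _))

section
variable [MeasurableSpace (Matrix.unitaryGroup (Fin n) ℂ)]
    [BorelSpace (Matrix.unitaryGroup (Fin n) ℂ)]
    (μ : Measure (Matrix.unitaryGroup (Fin n) ℂ)) [IsProbabilityMeasure μ]

lemma F_int (p q : Fin n × Fin n) : Integrable (fun U => F σ U p q) μ := by
  obtain ⟨C, hC⟩ := F_bound σ p q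
  exact Integrable.of_bound (F_cont σ p q).aestronglyMeasurable C (Filter.Eventually.of_forall hC)

/-- averaged matrix -/
noncomputable def avg : Matrix (Fin n × Fin n) (Fin n × Fin n) ℂ :=
  Matrix.of fun p q => ∫ U, F σ U p q ∂μ

lemma avg_mul (A B : Matrix (Fin n × Fin n) (Fin n × Fin n) ℂ) (p q : Fin n × Fin n) :
    ∫ U, (A * F σ U * B) p q ∂μ = (A * avg σ μ * B) p q := by
  simp only [Matrix.mul_apply, avg, Matrix.of_apply]
  rw [integral_finsetSum]
  · refine Finset.sum_congr rfl fun x _ => ?_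
    rw [integral_mul_const, integral_finsetSum]
    · simp only [integral_const_mul]
    · exact fun y _ => (F_int σ μ y x).const_mul _
  · exact fun x _ => (integrable_finsetSum _
      fun y _ => (F_int σ μ y x).const_mul _).mul_const _

lemma avg_trace (A : Matrix (Fin n × Fin n) (Fin n × Fin n) ℂ) :
    (A * avg σ μ).trace = ∫ U, (A * F σ U).trace ∂μ := by
  simp only [Matrix.trace, Matrix.diag_apply, Matrix.mul_apply]
  rw [integral_finsetSum]
  · refine Finset.sum_congr rfl fun x _ => ?_
    rw [integral_finsetSum]
    · simp only [integral_const_mul, avg, Matrix.of_apply]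
    · exact fun y _ => (F_int σ μ y x).const_mul _
  · exact fun x _ => (integrable_finsetSum _
      fun y _ => (F_int σ μ y x).const_mul _)

lemma avg_comm [μ.IsMulLeftInvariant] (V : Matrix (Fin n) (Fin n) ℂ)
    (hV : V ∈ Matrix.unitaryGroup (Fin n) ℂ) : Commute (avg σ μ) (V ⊗ₖ V) := by
  have h : avg σ μ = (V ⊗ₖ V) * avg σ μ * (V ⊗ₖ V)ᴴ := by
    ext p q
    rw [← avg_mul]
    have := integral_mul_left_eq_self (μ := μ) (fun U => F σ U p q) ⟨V, hV⟩
    simp only [F_mul] at this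
    rw [this]; rfl
  have h2 := kron_unitary ⟨V, hV⟩
  simp only at h2
  show avg σ μ * (V ⊗ₖ V) = (V ⊗ₖ V) * avg σ μ
  conv_lhs => rw [h]
  rw [mul_assoc, h2, mul_one]
end

end HaarTwirl

/-- Haar averaging (twirling) of a two-copy operator: for the normalized Haar probability
measure `μ` on the unitary group `U(n)` (a left-invariant probability measure) and any
`n²×n²` matrix `σ`, the entrywise integral
`∫ (U⊗U)·σ·(U⊗U)* dμ(U)` equals
`[(tr σ − tr(Sσ)/n)/(n²−1)]·I + [(tr(Sσ) − tr σ/n)/(n²−1)]·S`. -/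
theorem haar_two_copy_twirl (n : ℕ) (hn : 2 ≤ n)
    [MeasurableSpace (Matrix.unitaryGroup (Fin n) ℂ)]
    [BorelSpace (Matrix.unitaryGroup (Fin n) ℂ)]
    (μ : Measure (Matrix.unitaryGroup (Fin n) ℂ)) [IsProbabilityMeasure μ]
    [μ.IsMulLeftInvariant]
    (σ : Matrix (Fin n × Fin n) (Fin n × Fin n) ℂ) :
    ∀ p q : Fin n × Fin n,
      (∫ U : Matrix.unitaryGroup (Fin n) ℂ,
          ((((U : Matrix (Fin n) (Fin n) ℂ) ⊗ₖ (U : Matrix (Fin n) (Fin n) ℂ)) * σ *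
            (((U : Matrix (Fin n) (Fin n) ℂ) ⊗ₖ (U : Matrix (Fin n) (Fin n) ℂ))ᴴ)) p q) ∂μ) =
        ((((σ.trace - (swapOp n * σ).trace / (n : ℂ)) / ((n : ℂ) ^ 2 - 1)) •
            (1 : Matrix (Fin n × Fin n) (Fin n × Fin n) ℂ) +
          (((swapOp n * σ).trace - σ.trace / (n : ℂ)) / ((n : ℂ) ^ 2 - 1)) •
            swapOp n) p q) := by
  intro p q
  have h := HaarTwirl.commutant (HaarTwirl.avg σ μ) hn (HaarTwirl.avg_comm σ μ)
  have h1 : (HaarTwirl.avg σ μ).trace = σ.trace := by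
    have := HaarTwirl.avg_trace σ μ 1
    simpa [HaarTwirl.F_trace] using this
  have h2 : (swapOp n * HaarTwirl.avg σ μ).trace = (swapOp n * σ).trace := by
    have := HaarTwirl.avg_trace σ μ (swapOp n)
    simpa [HaarTwirl.F_swap_trace] using this
  rw [h1, h2] at h
  exact congrFun (congrFun h p) q
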